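/- Let α ∈ (0,1), ρ ∈ (−1,1), ā ∈ (0,1), and (a₁, a₂) ∈ [0,1]² with a₁ + a₂ ≤ ā. For θ ∈ ℝ, let μ_θ be the law on ℝ² of (Z₁, θ + ρZ₁ + √(1−ρ²)·Z₂), where Z₁, Z₂ are independent standard normal random variables. Define T(x,y) := a₁x² + a₂y² + (1 − a₁ − a₂)·((y − ρx)/√(1−ρ²))², let c > 0 satisfy μ₀{(x,y) : T(x,y) ≥ c} = α, and let φ_{a₁,a₂}(x,y) := 1{T(x,y) ≥ c}. Call a measurable test φ : ℝ² → [0,1] sign-invariant if φ(x,y) = φ(x, 2ρx − y) for all (x,y) (invariance to the sign change of the orthogonalized component y − ρx). Then φ_{a₁,a₂} is uniformly most powerful among level-α sign-invariant tests — i.e., for every sign-invariant measurable φ with ∫φ dμ₀ ≤ α and every θ ∈ ℝ, ∫φ dμ_θ ≤ ∫φ_{a₁,a₂} dμ_θ — if and only if a₁ = 0 and a₂·ρ = 0. Moreover, when a₁ = 0 and a₂·ρ = 0, φ_{a₁,a₂} is also uniformly most powerful among unbiased level-α tests (measurable φ : ℝ² → [0,1] with ∫φ dμ₀ ≤ α and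 ∫φ dμ_θ ≥ α for all θ ≠ 0). -/

import Mathlib

open MeasureTheory ProbabilityTheory

noncomputable section

abbrev GG : Measure (ℝ × ℝ) := (gaussianReal 0 1).prod (gaussianReal 0 1)

def psis (k : ℝ) (z : ℝ × ℝ) : ℝ := if k ≤ |z.2| then 1 else 0

lemma psis_meas (k : ℝ) : Measurable (psis k) := by
  unfold psis
  exact Measurable.ite (measurableSet_le measurable_const (by fun_prop)) measurable_const
    measurable_const

lemma psis_mem (k : ℝ) (z) : psis k z ∈ Set.Icc (0:ℝ) 1 := by
  unfold psis; split_ifs <;> simp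

lemma chord_in {k δ z : ℝ} (hk : 0 < k) (hz : |z| ≤ k) :
    2 * k * Real.exp (δ * z) ≤ (k + z) * Real.exp (δ * k) + (k - z) * Real.exp (δ * (-k)) := by
  obtain ⟨h1, h2⟩ := abs_le.1 hz
  have h := convexOn_exp.2 (Set.mem_univ (δ * k)) (Set.mem_univ (δ * (-k)))
    (show 0 ≤ (k + z) / (2 * k) from div_nonneg (by linarith) (by linarith))
    (show 0 ≤ (k - z) / (2 * k) from div_nonneg (by linarith) (by linarith))
    (by field_simp; ring)
  have e : (k + z) / (2 * k) * (δ * k) + (k - z) / (2 * k) * (δ * (-k)) = δ * z := by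
    field_simp; ring
  simp only [smul_eq_mul, e] at h
  have := mul_le_mul_of_nonneg_left h (show 0 ≤ 2 * k by linarith)
  calc _ ≤ _ := this
    _ = _ := by field_simp

lemma chord_in_lt {k δ z : ℝ} (hk : 0 < k) (hδ : δ ≠ 0) (hz : |z| < k) :
    2 * k * Real.exp (δ * z) < (k + z) * Real.exp (δ * k) + (k - z) * Real.exp (δ * (-k)) := by
  obtain ⟨h1, h2⟩ := abs_lt.1 hz
  have h := strictConvexOn_exp.2 (Set.mem_univ (δ * k)) (Set.mem_univ (δ * (-k)))
    (by intro h; have := mul_left_cancel₀ hδ h; linarith)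
    (show 0 < (k + z) / (2 * k) from div_pos (by linarith) (by linarith))
    (show 0 < (k - z) / (2 * k) from div_pos (by linarith) (by linarith))
    (by field_simp; ring)
  have e : (k + z) / (2 * k) * (δ * k) + (k - z) / (2 * k) * (δ * (-k)) = δ * z := by
    field_simp; ring
  simp only [smul_eq_mul, e] at h
  have := mul_lt_mul_of_pos_left h (show 0 < 2 * k by linarith)
  calc _ < _ := this
    _ = _ := by field_simp

lemma chord_out_aux {k δ z : ℝ} (hk : 0 < k) (hz : k ≤ z) :
    (k + z) * Real.exp (δ * k) + (k - z) * Real.exp (δ * (-k)) ≤ 2 * k * Real.exp (δ * z) := by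
  have hp : 0 < z + k := by linarith
  have h := convexOn_exp.2 (Set.mem_univ (δ * z)) (Set.mem_univ (δ * (-k)))
    (show 0 ≤ 2 * k / (z + k) from div_nonneg (by linarith) (by linarith))
    (show 0 ≤ (z - k) / (z + k) from div_nonneg (by linarith) (by linarith))
    (by field_simp; ring)
  have e : 2 * k / (z + k) * (δ * z) + (z - k) / (z + k) * (δ * (-k)) = δ * k := by
    field_simp; ring
  simp only [smul_eq_mul, e] at h
  have := mul_le_mul_of_nonneg_left h hp.le
  have e2 : (z + k) * (2 * k / (z + k) * Real.exp (δ * z) + (z - k) / (z + k) * Real.exp (δ * (-k)))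
    = 2 * k * Real.exp (δ * z) + (z - k) * Real.exp (δ * (-k)) := by field_simp
  rw [e2] at this
  linarith

lemma chord_out {k δ z : ℝ} (hk : 0 < k) (hz : k ≤ |z|) :
    (k + z) * Real.exp (δ * k) + (k - z) * Real.exp (δ * (-k)) ≤ 2 * k * Real.exp (δ * z) := by
  rcases le_abs.1 hz with h | h
  · exact chord_out_aux hk h
  · have := chord_out_aux (δ := -δ) hk h
    simp only [neg_mul, mul_neg, neg_neg] at this ⊢
    linarith

lemma exp_int (δ : ℝ) : Integrable (fun z : ℝ × ℝ => Real.exp (δ * z.2)) GG :=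
  (integrable_exp_mul_gaussianReal δ).comp_snd _

lemma id_int : Integrable (fun z : ℝ × ℝ => z.2) GG :=
  ((memLp_id_gaussianReal (μ := 0) (v := 1) 1).integrable (by simp)).comp_snd _

lemma mul_int {ψ f : ℝ × ℝ → ℝ} (hm : Measurable ψ) (hr : ∀ z, ψ z ∈ Set.Icc (0:ℝ) 1)
    (hf : Integrable f GG) : Integrable (fun z => ψ z * f z) GG :=
  hf.bdd_mul (c := 1) hm.aestronglyMeasurable
    (ae_of_all _ fun z => by rw [Real.norm_eq_abs, abs_of_nonneg (hr z).1]; exact (hr z).2)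

lemma bd_int {ψ : ℝ × ℝ → ℝ} (hm : Measurable ψ) (hr : ∀ z, ψ z ∈ Set.Icc (0:ℝ) 1) :
    Integrable ψ GG := by
  simpa using mul_int hm hr (integrable_const (1:ℝ))

lemma refl_mp : MeasurePreserving (fun x : ℝ => -x) (gaussianReal 0 1) (gaussianReal 0 1) :=
  ⟨by fun_prop, by rw [gaussianReal_map_neg]; simp⟩

lemma refl2 (f : ℝ × ℝ → ℝ) : ∫ z, f (z.1, -z.2) ∂GG = ∫ z, f z ∂GG :=
  MeasurePreserving.integral_comp
    ((MeasurePreserving.id _).prod refl_mp)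
    ((MeasurableEquiv.refl ℝ).prodCongr (MeasurableEquiv.neg ℝ)).measurableEmbedding f

lemma refl12 (f : ℝ × ℝ → ℝ) : ∫ z, f (-z.1, -z.2) ∂GG = ∫ z, f z ∂GG :=
  MeasurePreserving.integral_comp
    (refl_mp.prod refl_mp)
    ((MeasurableEquiv.neg ℝ).prodCongr (MeasurableEquiv.neg ℝ)).measurableEmbedding f

lemma odd2 {ψ : ℝ × ℝ → ℝ} (h : ∀ z : ℝ × ℝ, ψ (z.1, -z.2) = ψ z) : ∫ z, ψ z * z.2 ∂GG = 0 := by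
  have := refl2 (fun z => ψ z * z.2)
  simp only [h, mul_neg, integral_neg] at this
  linarith

lemma odd12 {ψ : ℝ × ℝ → ℝ} (h : ∀ z : ℝ × ℝ, ψ (-z.1, -z.2) = ψ z) : ∫ z, ψ z * z.2 ∂GG = 0 := by
  have := refl12 (fun z => ψ z * z.2)
  simp only [h, mul_neg, integral_neg] at this
  linarith

/-- generalized Neyman–Pearson -/
lemma np {k δ : ℝ} (hk : 0 < k) {ψ : ℝ × ℝ → ℝ} (hm : Measurable ψ)
    (hr : ∀ z, ψ z ∈ Set.Icc (0:ℝ) 1) (h0 : ∫ z, ψ z * z.2 ∂GG = 0)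
    (hle : ∫ z, ψ z ∂GG ≤ ∫ z, psis k z ∂GG) :
    ∫ z, ψ z * Real.exp (δ * z.2) ∂GG ≤ ∫ z, psis k z * Real.exp (δ * z.2) ∂GG ∧
    (δ ≠ 0 → ∀ U : Set (ℝ × ℝ), GG U ≠ 0 → (∀ z ∈ U, 0 < ψ z ∧ |z.2| < k) →
      ∫ z, ψ z * Real.exp (δ * z.2) ∂GG < ∫ z, psis k z * Real.exp (δ * z.2) ∂GG) := by
  set P := Real.exp (δ * k) with hP
  set Q := Real.exp (δ * (-k)) with hQ
  have hPp : 0 < P := Real.exp_pos _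
  have hQp : 0 < Q := Real.exp_pos _
  let h : ℝ × ℝ → ℝ := fun z => 2 * k * Real.exp (δ * z.2) - ((k + z.2) * P + (k - z.2) * Q)
  let F : ℝ × ℝ → ℝ := fun z => (psis k z - ψ z) * h z
  have hF0 : 0 ≤ F := by
    intro z
    simp only [F, h, psis, Pi.zero_apply]
    split_ifs with hz
    · exact mul_nonneg (by linarith [(hr z).2]) (by linarith [chord_out (δ := δ) hk hz])
    · exact mul_nonneg_of_nonpos_of_nonpos (by linarith [(hr z).1])
        (by linarith [chord_in (δ := δ) hk (not_le.1 hz).le])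
  have s0 : ∫ z, psis k z * z.2 ∂GG = 0 := odd2 (by intro z; simp [psis])
  have key : ∀ {f : ℝ × ℝ → ℝ}, Measurable f → (∀ z, f z ∈ Set.Icc (0:ℝ) 1) →
      (∫ z, f z * z.2 ∂GG = 0) → Integrable (fun z => f z * h z) GG ∧
      ∫ z, f z * h z ∂GG = 2 * k * (∫ z, f z * Real.exp (δ * z.2) ∂GG)
        - k * (P + Q) * ∫ z, f z ∂GG := by
    intro f fm fr f0
    have i1 := (mul_int fm fr (exp_int δ)).const_mul (2 * k)
    have i2 := (bd_int fm fr).const_mul (k * (P + Q))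
    have i3 := (mul_int fm fr id_int).const_mul (P - Q)
    have e : (fun z => f z * h z) = fun z => 2 * k * (f z * Real.exp (δ * z.2))
        - k * (P + Q) * f z - (P - Q) * (f z * z.2) := by
      funext z; simp only [h]; ring
    rw [e]
    refine ⟨(i1.sub i2).sub i3, ?_⟩
    have i12 : Integrable (fun z => 2 * k * (f z * Real.exp (δ * z.2)) - k * (P + Q) * f z) GG :=
      i1.sub i2
    rw [integral_sub i12 i3, integral_sub i1 i2, integral_const_mul, integral_const_mul,
      integral_const_mul, f0]
    ring
  obtain ⟨ia, ea⟩ := key (psis_meas k) (psis_mem k) s0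
  obtain ⟨ib, eb⟩ := key hm hr h0
  have hFe : F = fun z => psis k z * h z - ψ z * h z := by
    funext z; simp only [F]; ring
  have hFi : Integrable F GG := by rw [hFe]; exact ia.sub ib
  have hI : ∫ z, F z ∂GG = 2 * k * ((∫ z, psis k z * Real.exp (δ * z.2) ∂GG)
      - ∫ z, ψ z * Real.exp (δ * z.2) ∂GG)
      - k * (P + Q) * (∫ z, psis k z ∂GG - ∫ z, ψ z ∂GG) := by
    rw [hFe, integral_sub ia ib, ea, eb]; ring
  have hpos : 0 ≤ k * (P + Q) * (∫ z, psis k z ∂GG - ∫ z, ψ z ∂GG) :=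
    mul_nonneg (by positivity) (by linarith)
  constructor
  · have h1 : 0 ≤ ∫ z, F z ∂GG := integral_nonneg hF0
    have h2 : 0 ≤ 2 * k * ((∫ z, psis k z * Real.exp (δ * z.2) ∂GG)
      - ∫ z, ψ z * Real.exp (δ * z.2) ∂GG) := by linarith
    have := nonneg_of_mul_nonneg_right h2 (by linarith)
    linarith
  · intro hδ U hU hUz
    have h1 : 0 < ∫ z, F z ∂GG := by
      rw [integral_pos_iff_support_of_nonneg hF0 hFi]
      refine lt_of_lt_of_le (pos_iff_ne_zero.2 hU) (measure_mono ?_)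
      intro z hz
      obtain ⟨ha, hb⟩ := hUz z hz
      refine ne_of_gt ?_
      simp only [F, h, psis, if_neg (not_le.2 hb)]
      exact mul_pos_of_neg_of_neg (by linarith) (by linarith [chord_in_lt hk hδ hb])
    have h2 : 0 < 2 * k * ((∫ z, psis k z * Real.exp (δ * z.2) ∂GG)
      - ∫ z, ψ z * Real.exp (δ * z.2) ∂GG) := by linarith
    have := (mul_pos_iff_of_pos_left (show 0 < 2 * k by linarith)).1 h2
    linarith

lemma shift1 (g : ℝ → ℝ) (δ : ℝ) : ∫ x, g (x + δ) ∂(gaussianReal 0 1)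
    = Real.exp (-δ ^ 2 / 2) * ∫ x, g x * Real.exp (δ * x) ∂(gaussianReal 0 1) := by
  rw [integral_gaussianReal_eq_integral_smul (by simp),
    integral_gaussianReal_eq_integral_smul (by simp), ← integral_const_mul,
    ← integral_sub_right_eq_self _ δ]
  congr 1; funext x
  simp only [gaussianPDFReal, smul_eq_mul, sub_add_cancel]
  have : Real.exp (-(x - δ - 0) ^ 2 / (2 * ((1 : NNReal) : ℝ))) = Real.exp (-δ ^ 2 / 2) *
     (Real.exp (-(x - 0) ^ 2 / (2 * ((1 : NNReal) : ℝ))) * Real.exp (δ * x)) := by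
    rw [← Real.exp_add, ← Real.exp_add]; congr 1; simp; ring
  rw [this]; ring

lemma shift2 {f : ℝ × ℝ → ℝ} (hm : Measurable f) (hr : ∀ z, f z ∈ Set.Icc (0:ℝ) 1) (δ : ℝ) :
    ∫ z, f (z.1, z.2 + δ) ∂GG = Real.exp (-δ ^ 2 / 2) * ∫ z, f z * Real.exp (δ * z.2) ∂GG := by
  rw [integral_prod _ (bd_int (by fun_prop) (fun z => hr _)),
    integral_prod _ (mul_int hm hr (exp_int δ)), ← integral_const_mul]
  congr 1; funext x
  exact shift1 (fun y => f (x, y)) δ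

lemma unb {ψ : ℝ × ℝ → ℝ} (hm : Measurable ψ) (hr : ∀ z, ψ z ∈ Set.Icc (0:ℝ) 1) {α : ℝ}
    (h0 : ∫ z, ψ z ∂GG ≤ α) (h1 : ∀ δ : ℝ, δ ≠ 0 → α ≤ ∫ z, ψ z * Real.exp (δ * z.2) ∂GG) :
    ∫ z, ψ z * z.2 ∂GG = 0 := by
  let ν : Measure (ℝ × ℝ) := GG.withDensity (fun z => ENNReal.ofReal (ψ z))
  have hi : ∀ f : ℝ × ℝ → ℝ, ∫ z, f z ∂ν = ∫ z, ψ z * f z ∂GG := by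
    intro f
    rw [integral_withDensity_eq_integral_toReal_smul (by fun_prop) (by simp)]
    congr 1; funext z; simp [(hr z).1]
  have hx : interior (integrableExpSet (fun z : ℝ × ℝ => z.2) ν) = Set.univ := by
    have : integrableExpSet (fun z : ℝ × ℝ => z.2) ν = Set.univ := by
      ext t
      simp only [integrableExpSet, Set.mem_ofPred_eq, Set.mem_univ, iff_true]
      rw [integrable_withDensity_iff_integrable_smul' (by fun_prop) (by simp)]
      refine (mul_int hm hr (exp_int t)).congr (ae_of_all _ fun z => ?_)
      simp [(hr z).1]
    rw [this, interior_univ]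
  have hd := hasDerivAt_mgf (X := fun z : ℝ × ℝ => z.2) (μ := ν) (t := 0) (by rw [hx]; trivial)
  have hmgf : ∀ t, mgf (fun z : ℝ × ℝ => z.2) ν t = ∫ z, ψ z * Real.exp (t * z.2) ∂GG :=
    fun t => hi _
  have hmin : IsLocalMin (mgf (fun z : ℝ × ℝ => z.2) ν) 0 := by
    refine Filter.Eventually.of_forall fun t => ?_
    rw [hmgf, hmgf]
    rcases eq_or_ne t 0 with rfl | ht
    · exact le_rfl
    · refine le_trans ?_ (h1 t ht)
      simpa using h0
  have := hmin.hasDerivAt_eq_zero hd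
  rw [hi] at this
  simpa using this

lemma exists_k {α : ℝ} (hα : α ∈ Set.Ioo (0:ℝ) 1) : ∃ k, 0 < k ∧ ∫ z, psis k z ∂GG = α := by
  let p := gaussianPDFReal 0 1
  have pint : Integrable p := integrable_gaussianPDFReal 0 1
  let J : ℝ → ℝ := fun k => ∫ x in (-k)..k, p x
  have hJc : Continuous J := by
    have hp := intervalIntegral.continuous_primitive (fun a b => pint.intervalIntegrable) 0
      (f := p) (μ := volume)
    have : J = fun k => (∫ x in (0:ℝ)..k, p x) - ∫ x in (0:ℝ)..(-k), p x := by
      funext k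
      rw [intervalIntegral.integral_interval_sub_left pint.intervalIntegrable pint.intervalIntegrable]
    rw [this]
    exact hp.sub (hp.comp continuous_neg)
  have hlim : Filter.Tendsto J Filter.atTop (nhds 1) := by
    have := intervalIntegral_tendsto_integral pint Filter.tendsto_neg_atTop_atBot Filter.tendsto_id
    rwa [integral_gaussianPDFReal_eq_one 0 (by simp)] at this
  obtain ⟨K, hK1, hK0⟩ := ((hlim.eventually (lt_mem_nhds (show 1 - α < 1 by linarith [hα.1]))).and
    (Filter.eventually_ge_atTop 0)).exists
  have hJ0 : J 0 = 0 := by simp [J]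
  obtain ⟨k, hk, hkJ⟩ := intermediate_value_Icc hK0 hJc.continuousOn
    (show 1 - α ∈ Set.Icc (J 0) (J K) from ⟨by rw [hJ0]; linarith [hα.2], hK1.le⟩)
  have hk0 : 0 < k := by
    rcases hk.1.lt_or_eq with h | h
    · exact h
    · rw [← h, hJ0] at hkJ; linarith [hα.2]
  refine ⟨k, hk0, ?_⟩
  have e1 : ∫ z, psis k z ∂GG = ∫ x, (if k ≤ |x| then (1:ℝ) else 0) ∂(gaussianReal 0 1) := by
    rw [integral_prod _ (bd_int (psis_meas k) (psis_mem k))]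
    change ∫ _ : ℝ, (∫ y : ℝ, (if k ≤ |y| then (1:ℝ) else 0) ∂(gaussianReal 0 1))
      ∂(gaussianReal 0 1) = _
    rw [integral_const, probReal_univ, one_smul]
  have e2 : (fun x : ℝ => p x • (if k ≤ |x| then (1:ℝ) else 0))
      = fun x => p x - (Set.Ioo (-k) k).indicator p x := by
    funext x
    by_cases hx : k ≤ |x|
    · have : x ∉ Set.Ioo (-k) k := fun h => absurd (abs_lt.2 h) (not_lt.2 hx)
      simp [hx, this]
    · have : x ∈ Set.Ioo (-k) k := abs_lt.1 (not_le.1 hx)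
      rw [Set.indicator_of_mem this]; simp [hx]
  rw [e1, integral_gaussianReal_eq_integral_smul (by simp)]
  change ∫ x, p x • (if k ≤ |x| then (1:ℝ) else 0) = α
  rw [e2, integral_sub pint (pint.indicator measurableSet_Ioo), integral_indicator measurableSet_Ioo,
    ← integral_Ioc_eq_integral_Ioo, ← intervalIntegral.integral_of_le (by linarith)]
  change (∫ x, gaussianPDFReal 0 1 x) - J k = α
  rw [integral_gaussianPDFReal_eq_one 0 (by simp), hkJ]; ring

instance gopen : (gaussianReal 0 1).IsOpenPosMeasure :=
  (gaussianReal_absolutelyContinuous' 0 (by simp)).isOpenPosMeasure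

end

/-- Theorem 1(ii) of the paper: in the Gaussian limit experiment with
`(N₁, N₂)` bivariate normal with mean `(0, θ)`, unit variances and correlation `ρ`, the
linear combination test `1{T ≥ c}` with
`T(x,y) = a₁x² + a₂y² + (1−a₁−a₂)((y−ρx)/√(1−ρ²))²` is UMP among level-`α`
sign-invariant tests iff `a₁ = 0` and `a₂ρ = 0`; and in that case it is also UMP among
unbiased level-`α` tests. -/
theorem stmt_13 (α : ℝ) (hα : α ∈ Set.Ioo (0 : ℝ) 1)
    (ρ : ℝ) (hρ : ρ ∈ Set.Ioo (-1 : ℝ) 1)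
    (abar : ℝ) (habar : abar ∈ Set.Ioo (0 : ℝ) 1)
    (a₁ a₂ : ℝ) (ha₁ : a₁ ∈ Set.Icc (0 : ℝ) 1) (ha₂ : a₂ ∈ Set.Icc (0 : ℝ) 1)
    (hsum : a₁ + a₂ ≤ abar)
    (μ : ℝ → Measure (ℝ × ℝ))
    (hμ : ∀ θ : ℝ, μ θ = Measure.map
      (fun z : ℝ × ℝ => (z.1, θ + ρ * z.1 + Real.sqrt (1 - ρ ^ 2) * z.2))
      ((gaussianReal 0 1).prod (gaussianReal 0 1)))
    (T : ℝ × ℝ → ℝ)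
    (hT : T = fun p => a₁ * p.1 ^ 2 + a₂ * p.2 ^ 2 +
      (1 - a₁ - a₂) * ((p.2 - ρ * p.1) / Real.sqrt (1 - ρ ^ 2)) ^ 2)
    (c : ℝ) (hc : 0 < c)
    (hsize : μ 0 {p : ℝ × ℝ | c ≤ T p} = ENNReal.ofReal α) :
    ((∀ φ : ℝ × ℝ → ℝ, Measurable φ → (∀ p, φ p ∈ Set.Icc (0 : ℝ) 1) →
        (∀ x y : ℝ, φ (x, y) = φ (x, 2 * ρ * x - y)) →
        (∫ p, φ p ∂(μ 0)) ≤ α →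
        ∀ θ : ℝ, (∫ p, φ p ∂(μ θ)) ≤ ∫ p, (if c ≤ T p then (1 : ℝ) else 0) ∂(μ θ))
      ↔ (a₁ = 0 ∧ a₂ * ρ = 0)) ∧
    ((a₁ = 0 ∧ a₂ * ρ = 0) →
      ∀ φ : ℝ × ℝ → ℝ, Measurable φ → (∀ p, φ p ∈ Set.Icc (0 : ℝ) 1) →
        (∫ p, φ p ∂(μ 0)) ≤ α → (∀ θ : ℝ, θ ≠ 0 → α ≤ ∫ p, φ p ∂(μ θ)) →
        ∀ θ : ℝ, (∫ p, φ p ∂(μ θ)) ≤ ∫ p, (if c ≤ T p then (1 : ℝ) else 0) ∂(μ θ)) := by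
  have hs2 : 0 < 1 - ρ ^ 2 := by nlinarith [hρ.1, hρ.2]
  set s := Real.sqrt (1 - ρ ^ 2) with hs
  have hsp : 0 < s := Real.sqrt_pos.2 hs2
  have hss : s ^ 2 = 1 - ρ ^ 2 := Real.sq_sqrt hs2.le
  have hTm : Measurable T := by rw [hT]; fun_prop
  let φT : ℝ × ℝ → ℝ := fun p => if c ≤ T p then (1 : ℝ) else 0
  have hφTm : Measurable φT :=
    Measurable.ite (measurableSet_le measurable_const hTm) measurable_const measurable_const
  have hφTr : ∀ p, φT p ∈ Set.Icc (0:ℝ) 1 := by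
    intro p; simp only [φT]; split_ifs <;> simp
  let W : ℝ × ℝ → ℝ × ℝ := fun z => (z.1, ρ * z.1 + s * z.2)
  have hWm : Measurable W := by fun_prop
  have trans : ∀ (φ : ℝ × ℝ → ℝ), Measurable φ → (∀ p, φ p ∈ Set.Icc (0:ℝ) 1) → ∀ θ,
      ∫ p, φ p ∂(μ θ) = Real.exp (-(θ / s) ^ 2 / 2) *
        ∫ z, φ (W z) * Real.exp (θ / s * z.2) ∂GG := by
    intro φ hm hr θ
    rw [hμ, integral_map (by fun_prop) hm.aestronglyMeasurable,
      ← shift2 (f := fun z => φ (W z)) (hm.comp hWm) (fun z => hr _)]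
    congr 1; funext z
    simp only [W]
    congr 2
    field_simp; ring
  have trans0 : ∀ (φ : ℝ × ℝ → ℝ), Measurable φ → (∀ p, φ p ∈ Set.Icc (0:ℝ) 1) →
      ∫ p, φ p ∂(μ 0) = ∫ z, φ (W z) ∂GG := by
    intro φ hm hr
    rw [trans φ hm hr 0]; simp
  have hTsize : ∫ z, φT (W z) ∂GG = α := by
    rw [← trans0 φT hφTm hφTr]
    have : φT = Set.indicator {p : ℝ × ℝ | c ≤ T p} 1 := by
      funext p; simp [φT, Set.indicator]
    rw [this, integral_indicator_one (measurableSet_le measurable_const hTm), Measure.real, hsize,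
      ENNReal.toReal_ofReal hα.1.le]
  have hTW : ∀ z, T (W z) = a₁ * z.1 ^ 2 + a₂ * (ρ * z.1 + s * z.2) ^ 2
      + (1 - a₁ - a₂) * z.2 ^ 2 := by
    intro z
    rw [hT]; simp only [W]
    have : (ρ * z.1 + s * z.2 - ρ * z.1) / s = z.2 := by field_simp; ring
    rw [this]
  have hgood : (a₁ = 0 ∧ a₂ * ρ = 0) → (fun z => φT (W z)) = psis (Real.sqrt c) := by
    rintro ⟨h1, h2⟩
    funext z
    have : T (W z) = z.2 ^ 2 := by
      rw [hTW, h1]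
      have : a₂ * (ρ * z.1 + s * z.2) ^ 2 = (a₂ * ρ) * (ρ * z.1 ^ 2 + 2 * s * z.1 * z.2)
        + (a₂ - (a₂ * ρ) * ρ) * z.2 ^ 2 := by linear_combination a₂ * z.2 ^ 2 * hss
      rw [this, h2]; ring
    simp only [φT, psis, this]
    congr 1
    rw [← Real.sqrt_sq_eq_abs, Real.sqrt_le_sqrt_iff (sq_nonneg _)]
  have hsc : 0 < Real.sqrt c := Real.sqrt_pos.2 hc
  have main : (a₁ = 0 ∧ a₂ * ρ = 0) → ∀ φ : ℝ × ℝ → ℝ, Measurable φ →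
      (∀ p, φ p ∈ Set.Icc (0 : ℝ) 1) → (∫ p, φ p ∂(μ 0)) ≤ α →
      (∫ z, φ (W z) * z.2 ∂GG = 0) →
      ∀ θ : ℝ, (∫ p, φ p ∂(μ θ)) ≤ ∫ p, φT p ∂(μ θ) := by
    intro hh φ hm hr hle h0 θ
    rw [trans φ hm hr, trans φT hφTm hφTr]
    refine mul_le_mul_of_nonneg_left ?_ (Real.exp_pos _).le
    rw [trans0 φ hm hr, ← hTsize, hgood hh] at hle
    have := (np (δ := θ / s) hsc (hm.comp hWm) (fun z => hr _) h0 hle).1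
    rw [← hgood hh] at this
    exact this
  refine ⟨⟨?_, ?_⟩, ?_⟩
  · intro H
    by_contra hne
    have hA : 0 < a₁ + a₂ * ρ ^ 2 := by
      rcases ha₁.1.lt_or_eq with h | h
      · have := mul_nonneg ha₂.1 (sq_nonneg ρ); linarith
      · have h2 : a₂ * ρ ≠ 0 := fun h2 => hne ⟨h.symm, h2⟩
        have h3 : a₂ ≠ 0 := left_ne_zero_of_mul h2
        have h4 : ρ ≠ 0 := right_ne_zero_of_mul h2
        have h5 : 0 < a₂ := lt_of_le_of_ne ha₂.1 (Ne.symm h3)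
        have : 0 < ρ ^ 2 := by positivity
        have := mul_pos h5 this
        linarith
    obtain ⟨k, hk, hkα⟩ := exists_k hα
    let φs : ℝ × ℝ → ℝ := fun p => psis k (p.1, (p.2 - ρ * p.1) / s)
    have hφsm : Measurable φs := (psis_meas k).comp (by fun_prop)
    have hφsW : ∀ z, φs (W z) = psis k z := by
      intro z
      simp only [φs, W]
      congr 2
      field_simp; ring
    have h1 := H φs hφsm (fun p => psis_mem k _) (by
      intro x y
      simp only [φs, psis]
      have : (2 * ρ * x - y - ρ * x) / s = -((y - ρ * x) / s) := by ring
      rw [this, abs_neg]) (by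
      rw [trans0 φs hφsm (fun p => psis_mem k _)]
      simp only [hφsW, hkα, le_refl]) s
    change _ ≤ ∫ p, φT p ∂(μ s) at h1
    rw [trans φs hφsm (fun p => psis_mem k _), trans φT hφTm hφTr, div_self hsp.ne'] at h1
    simp only [hφsW] at h1
    have h1 := le_of_mul_le_mul_left h1 (Real.exp_pos _)
    let U : Set (ℝ × ℝ) := {z | c < T (W z) ∧ |z.2| < k}
    have hU : IsOpen U := by
      have e : (fun z => T (W z)) = _ := funext hTW
      have hcont : Continuous (fun z => T (W z)) := by rw [e]; fun_prop
      exact (isOpen_lt continuous_const hcont).inter (isOpen_lt (continuous_snd.abs) continuous_const)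
    have hUne : U.Nonempty := by
      refine ⟨(Real.sqrt ((c + 1) / (a₁ + a₂ * ρ ^ 2)), 0), ?_, by simpa using hk⟩
      rw [hTW]
      have e := Real.sq_sqrt (show 0 ≤ (c + 1) / (a₁ + a₂ * ρ ^ 2) by positivity)
      have e2 : (a₁ + a₂ * ρ ^ 2) * ((c + 1) / (a₁ + a₂ * ρ ^ 2)) = c + 1 := by field_simp
      rw [← e] at e2
      simp only [mul_zero, add_zero]
      linarith
    have h2 := (np (δ := 1) hk (hφTm.comp hWm) (fun z => hφTr _)
      (odd12 (by
        intro z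
        have : T (W (-z.1, -z.2)) = T (W z) := by rw [hTW, hTW]; ring
        simp only [Function.comp, φT, this]))
      (by rw [hkα]; exact hTsize.le)).2 one_ne_zero U (hU.measure_ne_zero _ hUne) (by
        rintro z ⟨hz1, hz2⟩
        refine ⟨?_, hz2⟩
        simp [φT, hz1.le])
    exact absurd h1 (not_le.2 h2)
  · intro hh φ hm hr hinv hle
    refine main hh φ hm hr hle (odd2 (ψ := fun z => φ (W z)) ?_)
    intro z
    simp only [W]
    rw [hinv]
    congr 2
    ring
  · intro hh φ hm hr hle hunb
    refine main hh φ hm hr hle (unb (α := α) (hm.comp hWm) (fun z => hr _) ?_ ?_)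
    · rw [trans0 φ hm hr] at hle; exact hle
    · intro δ hδ
      have h := hunb (s * δ) (mul_ne_zero hsp.ne' hδ)
      rw [trans φ hm hr, mul_div_cancel_left₀ _ hsp.ne'] at h
      refine h.trans ?_
      have : Real.exp (-δ ^ 2 / 2) ≤ 1 := Real.exp_le_one_iff.2 (by nlinarith [sq_nonneg δ])
      exact mul_le_of_le_one_left
        (integral_nonneg fun z => mul_nonneg (hr _).1 (Real.exp_pos _).le) this
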